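/- Let n ≥ 2 and let k be an integer with 2 ≤ k ≤ n. Let B ⊆ ℝⁿ be an open ball centered at the origin, let u be a classical solution of problem (P) on B, and let θ be a solution of problem (★) on B which is the unique such solution; suppose there exist constants a ≥ 1 and 0 < b ≤ 1 with a·θ(x) ≤ u(0,x) ≤ b·θ(x) for all x ∈ B̄. Then θ is radially symmetric, i.e. θ(x) = θ(y) whenever |x| = |y|, and sup_{x ∈ B̄} |(1+t)^{1/(k-1)} u(t,x) − θ(x)| → 0 as t → ∞; in other words, (1+t)^{1/(k-1)} u(t,·) converges uniformly on B̄ to a radially symmetric limit. -/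

import Mathlib

open scoped BigOperators
open Metric Set MeasureTheory Filter

noncomputable section

/-- The Hessian matrix of a real-valued function `u` at the point `x`,
whose `(i,j)` entry is `∂²u/∂xᵢ∂xⱼ (x)`. -/
def hessianMatrix (n : ℕ) (u : EuclideanSpace ℝ (Fin n) → ℝ)
    (x : EuclideanSpace ℝ (Fin n)) : Matrix (Fin n) (Fin n) ℝ :=
  Matrix.of fun i j =>
    iteratedFDeriv ℝ 2 u x ![EuclideanSpace.single i (1 : ℝ), EuclideanSpace.single j (1 : ℝ)]

/-- Sum of all `k × k` principal minors of an `n × n` matrix; for a symmetric matrix this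
is the `k`-th elementary symmetric function of its eigenvalues. -/
def sumPrincipalMinors (n k : ℕ) (A : Matrix (Fin n) (Fin n) ℝ) : ℝ :=
  ∑ s ∈ (Finset.univ : Finset (Fin n)).powersetCard k,
    (A.submatrix (fun i : {i // i ∈ s} => (i : Fin n))
      (fun i : {i // i ∈ s} => (i : Fin n))).det

/-- The `k`-Hessian operator `S_k(D²u)(x)`. -/
def SkHess (n k : ℕ) (u : EuclideanSpace ℝ (Fin n) → ℝ)
    (x : EuclideanSpace ℝ (Fin n)) : ℝ :=
  sumPrincipalMinors n k (hessianMatrix n u x)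

/-- `u` is `k`-admissible on the bounded open set `Ω`:
`u ∈ C²(Ω) ∩ C(Ω̄)` and `S_j(D²u) > 0` in `Ω` for every `j = 1, …, k`. -/
def KAdmissible (n k : ℕ) (Ω : Set (EuclideanSpace ℝ (Fin n)))
    (u : EuclideanSpace ℝ (Fin n) → ℝ) : Prop :=
  ContDiffOn ℝ 2 u Ω ∧ ContinuousOn u (closure Ω) ∧
    ∀ j, 1 ≤ j → j ≤ k → ∀ x ∈ Ω, 0 < SkHess n j u x

/-- `θ` is a solution of problem (★) on `Ω`:
`θ` is `k`-admissible, `θ < 0` in `Ω`, `θ = 0` on `∂Ω` and `S_k(D²θ) = -θ/(k-1)` in `Ω`. -/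
def IsStarSolution (n k : ℕ) (Ω : Set (EuclideanSpace ℝ (Fin n)))
    (θ : EuclideanSpace ℝ (Fin n) → ℝ) : Prop :=
  KAdmissible n k Ω θ ∧ (∀ x ∈ Ω, θ x < 0) ∧ (∀ x ∈ frontier Ω, θ x = 0) ∧
    ∀ x ∈ Ω, SkHess n k θ x = -θ x / ((k : ℝ) - 1)

/-- `u : [0,∞) × Ω̄ → ℝ` is a classical solution of problem (P):
`∂ₜu = S_k(D²u)` in `(0,∞) × Ω`, `u(t,·)` is `k`-admissible for each `t ≥ 0`,
and `u = 0` on `[0,∞) × ∂Ω`. -/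
def IsSolutionP (n k : ℕ) (Ω : Set (EuclideanSpace ℝ (Fin n)))
    (u : ℝ → EuclideanSpace ℝ (Fin n) → ℝ) : Prop :=
  (∀ t : ℝ, 0 < t → ∀ x ∈ Ω, HasDerivAt (fun s => u s x) (SkHess n k (u t) x) t) ∧
    (∀ t : ℝ, 0 ≤ t → KAdmissible n k Ω (u t)) ∧
    (∀ t : ℝ, 0 ≤ t → ∀ x ∈ frontier Ω, u t x = 0)

/-- `sup_Ω |θ|`. -/
def supAbs (n : ℕ) (Ω : Set (EuclideanSpace ℝ (Fin n)))
    (θ : EuclideanSpace ℝ (Fin n) → ℝ) : ℝ :=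
  sSup ((fun x => |θ x|) '' Ω)

open Polynomial in
theorem laguerre_prod (s : Multiset ℝ) (x : ℝ) :
    0 ≤ (eval x (derivative (s.map (fun a => X - C a)).prod)) ^ 2 -
      eval x (s.map (fun a => X - C a)).prod *
      eval x (derivative (derivative (s.map (fun a => X - C a)).prod)) := by
  induction s using Multiset.induction_on with
  | empty => simp
  | cons a s ih =>
    simp only [Multiset.map_cons, Multiset.prod_cons, derivative_mul, derivative_sub, derivative_X,
      derivative_C, sub_zero, one_mul, derivative_add, eval_add, eval_mul, eval_sub, eval_X, eval_C]
    set q := (s.map (fun a => X - C a)).prod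
    nlinarith [sq_nonneg (eval x q), mul_nonneg (sq_nonneg (x - a)) ih]

open Polynomial in
theorem laguerre (p : ℝ[X]) (hp : p.Splits) (x : ℝ) :
    0 ≤ (eval x (derivative p)) ^ 2 - eval x p * eval x (derivative (derivative p)) := by
  have h := hp.eq_prod_roots
  have h2 := laguerre_prod p.roots x
  set q := (p.roots.map (fun a => X - C a)).prod with hq
  rw [h]
  simp only [derivative_C_mul, eval_mul, eval_C]
  nlinarith [mul_nonneg (sq_nonneg p.leadingCoeff) h2]

open Polynomial in
theorem splits_deriv (p : ℝ[X]) (hp : p.Splits) : (derivative p).Splits := by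
  rw [splits_iff_card_roots] at hp ⊢
  have h1 := card_roots_le_derivative p
  have h2 := card_roots' (derivative p)
  have h3 := natDegree_derivative_le p
  by_cases h0 : p.natDegree = 0
  · rw [natDegree_eq_zero] at h0
    obtain ⟨c, rfl⟩ := h0
    simp
  · omega

open Polynomial in
theorem splits_iter_deriv (p : ℝ[X]) (hp : p.Splits) (m : ℕ) : (derivative^[m] p).Splits := by
  induction m with
  | zero => simpa
  | succ m ih => rw [Function.iterate_succ_apply']; exact splits_deriv _ ih

def esy {ι : Type*} (d : ι → ℝ) (s : Finset ι) (j : ℕ) : ℝ :=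
  ∑ t ∈ s.powersetCard j, ∏ i ∈ t, d i

open Polynomial in
theorem newton {ι : Type*} (d : ι → ℝ) (s : Finset ι) (j : ℕ) :
    esy d s j * esy d s (j + 2) ≤ esy d s (j + 1) ^ 2 := by
  by_cases hj : s.card < j + 2
  · have : esy d s (j + 2) = 0 := by
      unfold esy; rw [Finset.powersetCard_eq_empty.2 hj]; simp
    rw [this]; nlinarith [sq_nonneg (esy d s (j + 1))]
  push Not at hj
  obtain ⟨m, hm⟩ := Nat.exists_eq_add_of_le hj
  set P : ℝ[X] := ∏ i ∈ s, (X + C (d i)) with hP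
  have hPs : P.Splits := by
    rw [hP]
    refine Splits.prod fun i _ => ?_
    exact Splits.X_add_C _
  have hL := laguerre _ (splits_iter_deriv P hPs m) 0
  rw [← Function.iterate_succ_apply' derivative, ← Function.iterate_succ_apply' derivative] at hL
  simp only [← coeff_zero_eq_eval_zero, coeff_iterate_derivative, zero_add] at hL
  rw [hP, Finset.prod_X_add_C_coeff _ _ (by omega), Finset.prod_X_add_C_coeff _ _ (by omega),
    Finset.prod_X_add_C_coeff _ _ (by omega)] at hL
  rw [show s.card - (m+1).succ = j by omega, show s.card - m.succ = j + 1 by omega,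
    show s.card - m = j + 2 by omega] at hL
  simp only [Nat.descFactorial_self, nsmul_eq_mul, Nat.succ_eq_add_one, Nat.factorial_succ] at hL
  push_cast at hL
  have hL' : 0 ≤ (((m:ℝ) + 1) * (m.factorial:ℝ) * esy d s (j+1)) ^ 2 -
      ((m.factorial:ℝ) * esy d s (j+2)) * (((m:ℝ) + 1 + 1) * (((m:ℝ) + 1) * (m.factorial:ℝ)) * esy d s j) := hL
  have hF : (0:ℝ) < (m.factorial:ℝ) := by exact_mod_cast m.factorial_pos
  have hm0 : (0:ℝ) ≤ m := Nat.cast_nonneg m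
  generalize (m.factorial:ℝ) = F at *
  generalize (m:ℝ) = c at *
  generalize esy d s j = E0 at *
  generalize esy d s (j+1) = E1 at *
  generalize esy d s (j+2) = E2 at *
  have h1 : 0 ≤ (F ^ 2 * (c+1)) * ((c+1) * E1 ^ 2 - (c+2) * (E0 * E2)) := by
    nlinarith [hL']
  have h2 := nonneg_of_mul_nonneg_right h1 (by positivity)
  by_cases h : E0 * E2 ≤ 0
  · nlinarith [sq_nonneg E1]
  · push Not at h
    nlinarith

theorem esy_insert {ι : Type*} [DecidableEq ι] (d : ι → ℝ) (s : Finset ι) (i : ι) (hi : i ∉ s)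
    (j : ℕ) : esy d (insert i s) (j+1) = esy d s (j+1) + d i * esy d s j := by
  unfold esy
  rw [Finset.powersetCard_succ_insert hi, Finset.sum_union, Finset.sum_image]
  · congr 1
    rw [Finset.mul_sum]
    refine Finset.sum_congr rfl fun t ht => ?_
    rw [Finset.prod_insert]
    intro h
    exact hi ((Finset.mem_powersetCard.1 ht).1 h)
  · intro a ha b hb hab
    have ha' : i ∉ a := fun h => hi ((Finset.mem_powersetCard.1 ha).1 h)
    have hb' : i ∉ b := fun h => hi ((Finset.mem_powersetCard.1 hb).1 h)
    rw [← Finset.erase_insert ha', ← Finset.erase_insert hb', hab]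
  · rw [Finset.disjoint_left]
    intro t ht ht'
    obtain ⟨r, hr, rfl⟩ := Finset.mem_image.1 ht'
    exact hi ((Finset.mem_powersetCard.1 ht).1 (Finset.mem_insert_self _ _))

theorem gamma_erase {ι : Type*} [DecidableEq ι] (d : ι → ℝ) (s : Finset ι) (i : ι) (hi : i ∈ s)
    (k : ℕ) (h : ∀ j, 1 ≤ j → j ≤ k → 0 < esy d s j) (j : ℕ) (hj : j < k) :
    0 < esy d (s.erase i) j := by
  induction j with
  | zero => simp [esy]
  | succ j ih =>
    have ih := ih (by omega)
    have hni : i ∉ s.erase i := by simp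
    have h1 := h (j+1) (by omega) (by omega)
    have h2 := h (j+2) (by omega) (by omega)
    rw [← Finset.insert_erase hi, esy_insert _ _ _ hni] at h1
    rw [← Finset.insert_erase hi, esy_insert _ _ _ hni (j+1)] at h2
    have hN := newton d (s.erase i) j
    simp only [show j + 1 + 1 = j + 2 from rfl] at h2
    generalize esy d (s.erase i) j = E0 at *
    generalize esy d (s.erase i) (j+1) = E1 at *
    generalize esy d (s.erase i) (j+2) = E2 at *
    by_contra hc
    push Not at hc
    nlinarith [mul_pos ih h2, mul_nonneg (neg_nonneg.2 hc) h1.le]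

theorem det_diag_rank_one {ι : Type*} [Fintype ι] [DecidableEq ι] (d v : ι → ℝ) :
    (Matrix.diagonal d + Matrix.vecMulVec v v).det =
      ∏ i, d i + ∑ i, v i ^ 2 * ∏ j ∈ Finset.univ.erase i, d j := by
  have key : ∀ e : ι → ℝ, (∀ i, e i ≠ 0) → (Matrix.diagonal e + Matrix.vecMulVec v v).det =
      ∏ i, e i + ∑ i, v i ^ 2 * ∏ j ∈ Finset.univ.erase i, e j := by
    intro e he
    have hu : IsUnit (Matrix.diagonal e).det := by
      rw [Matrix.det_diagonal]
      exact (Finset.prod_ne_zero_iff.2 fun i _ => he i).isUnit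
    rw [Matrix.vecMulVec_eq Unit, Matrix.det_add_replicateCol_mul_replicateRow hu,
      Matrix.det_diagonal, Matrix.det_unique, Matrix.inv_diagonal]
    simp only [Matrix.add_apply, Matrix.one_apply_eq, mul_add, mul_one, add_right_inj]
    rw [Matrix.mul_apply]
    simp only [Matrix.replicateCol_apply, Matrix.mul_diagonal, Matrix.replicateRow_apply]
    rw [Finset.mul_sum]
    refine Finset.sum_congr rfl fun i _ => ?_
    rw [← Finset.mul_prod_erase _ _ (Finset.mem_univ i)]
    have : Ring.inverse e i = (e i)⁻¹ := by
      have : Ring.inverse e = fun i => (e i)⁻¹ := by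
        have hu : IsUnit e := Pi.isUnit_iff.2 fun i => (he i).isUnit
        have h1 := (Ring.inverse_mul_eq_iff_eq_mul e 1 (fun i => (e i)⁻¹) hu).2
          (by ext i; simp [he i])
        simpa using h1
      rw [this]
    rw [this]
    field_simp [he i]
  have h1 : Tendsto (fun ε : ℝ => (Matrix.diagonal (fun i => d i + ε) + Matrix.vecMulVec v v).det)
      (nhdsWithin 0 {0}ᶜ) (nhds (Matrix.diagonal d + Matrix.vecMulVec v v).det) := by
    have : Continuous (fun ε : ℝ => (Matrix.diagonal (fun i => d i + ε) + Matrix.vecMulVec v v).det) := by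
      fun_prop
    have := this.tendsto 0
    simp only [add_zero] at this
    exact this.mono_left nhdsWithin_le_nhds
  have h2 : Tendsto (fun ε : ℝ => ∏ i, (d i + ε) + ∑ i, v i ^ 2 * ∏ j ∈ Finset.univ.erase i, (d j + ε))
      (nhdsWithin 0 {0}ᶜ) (nhds (∏ i, d i + ∑ i, v i ^ 2 * ∏ j ∈ Finset.univ.erase i, d j)) := by
    have : Continuous (fun ε : ℝ => ∏ i, (d i + ε) + ∑ i, v i ^ 2 * ∏ j ∈ Finset.univ.erase i, (d j + ε)) := by
      fun_prop
    have := this.tendsto 0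
    simp only [add_zero] at this
    exact this.mono_left nhdsWithin_le_nhds
  refine tendsto_nhds_unique (h1.congr' ?_) h2
  have : ∀ᶠ ε : ℝ in nhdsWithin 0 {0}ᶜ, ∀ i, d i + ε ≠ 0 := by
    rw [eventually_all]
    intro i
    by_cases h : d i = 0
    · filter_upwards [self_mem_nhdsWithin] with ε hε
      simpa [h] using hε
    · have : Continuous (fun ε : ℝ => d i + ε) := by fun_prop
      have := (this.tendsto 0).eventually_ne (b₂ := (0:ℝ)) (by simpa using h)
      exact this.filter_mono nhdsWithin_le_nhds
  filter_upwards [this] with ε hε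
  exact key _ hε

theorem spm_diag (n k : ℕ) (d : Fin n → ℝ) :
    sumPrincipalMinors n k (Matrix.diagonal d) = esy d Finset.univ k := by
  unfold sumPrincipalMinors esy
  refine Finset.sum_congr rfl fun s _ => ?_
  rw [Matrix.submatrix_diagonal _ _ Subtype.val_injective, Matrix.det_diagonal]
  exact Finset.prod_coe_sort s d

theorem spm_diag_rank_one (n k : ℕ) (d v : Fin n → ℝ) :
    sumPrincipalMinors n (k+1) (Matrix.diagonal d + Matrix.vecMulVec v v) =
      esy d Finset.univ (k+1) + ∑ i, v i ^ 2 * esy d (Finset.univ.erase i) k := by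
  have h1 : sumPrincipalMinors n (k+1) (Matrix.diagonal d + Matrix.vecMulVec v v) =
      ∑ s ∈ (Finset.univ : Finset (Fin n)).powersetCard (k+1),
        (∏ i ∈ s, d i + ∑ i ∈ s, v i ^ 2 * ∏ j ∈ s.erase i, d j) := by
    unfold sumPrincipalMinors
    refine Finset.sum_congr rfl fun s _ => ?_
    have := det_diag_rank_one (fun i : {i // i ∈ s} => d i) (fun i => v i)
    rw [show (Matrix.diagonal d + Matrix.vecMulVec v v).submatrix (fun i : {i // i ∈ s} => (i : Fin n))
      (fun i : {i // i ∈ s} => (i : Fin n)) = Matrix.diagonal (fun i : {i // i ∈ s} => d i) +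
        Matrix.vecMulVec (fun i : {i // i ∈ s} => v i) (fun i : {i // i ∈ s} => v i) from ?_, this]
    · congr 1
      · exact Finset.prod_coe_sort s d
      · rw [← Finset.sum_coe_sort s]
        refine Finset.sum_congr rfl fun i _ => ?_
        congr 1
        refine Finset.prod_bij (fun j _ => (j : Fin n)) ?_ ?_ ?_ ?_
        · intro j hj
          simp only [Finset.mem_erase, Finset.mem_univ, and_true] at hj ⊢
          exact ⟨fun h => hj (Subtype.ext h), j.2⟩
        · intro a _ b _ h; exact Subtype.ext h
        · intro b hb
          rw [Finset.mem_erase] at hb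
          exact ⟨⟨b, hb.2⟩, by simp only [Finset.mem_erase, Finset.mem_univ, and_true]; exact fun h => hb.1 (congrArg Subtype.val h), rfl⟩
        · intros; rfl
    · ext i j
      simp only [Matrix.submatrix_apply, Matrix.add_apply, Matrix.diagonal_apply,
        Matrix.vecMulVec_apply, Subtype.ext_iff]
  rw [h1, Finset.sum_add_distrib]
  congr 1
  simp only [esy, Finset.mul_sum]
  rw [Finset.sum_sigma', Finset.sum_sigma']
  refine Finset.sum_bij' (fun p _ => ⟨p.2, p.1.erase p.2⟩) (fun p _ => ⟨insert p.1 p.2, p.1⟩) ?_ ?_ ?_ ?_ ?_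
  · rintro ⟨s, i⟩ h
    simp only [Finset.mem_sigma, Finset.mem_powersetCard, Finset.mem_univ, true_and] at h ⊢
    refine ⟨Finset.erase_subset_erase _ (Finset.subset_univ _), ?_⟩
    rw [Finset.card_erase_of_mem h.2]; omega
  · rintro ⟨i, s⟩ h
    simp only [Finset.mem_sigma, Finset.mem_powersetCard, Finset.mem_univ, true_and] at h ⊢
    have : i ∉ s := fun hi => by simpa using h.1 hi
    refine ⟨⟨Finset.subset_univ _, ?_⟩, Finset.mem_insert_self _ _⟩
    rw [Finset.card_insert_of_notMem this]; omega
  · rintro ⟨s, i⟩ h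
    simp only [Finset.mem_sigma] at h
    simp [Finset.insert_erase h.2]
  · rintro ⟨i, s⟩ h
    simp only [Finset.mem_sigma, Finset.mem_powersetCard, Finset.mem_univ, true_and] at h
    have : i ∉ s := fun hi => by simpa using h.1 hi
    simp [Finset.erase_insert this]
  · intros; rfl

theorem spm_conj (n k : ℕ) (A U V : Matrix (Fin n) (Fin n) ℝ) (hUV : V * U = 1) :
    sumPrincipalMinors n k (U * A * V) = sumPrincipalMinors n k A := by
  by_cases hk : k ≤ n
  · have h1 := Matrix.charpoly_coeff_eq_sum_minors (U * A * V) k (by simpa using hk)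
    have h2 := Matrix.charpoly_coeff_eq_sum_minors A k (by simpa using hk)
    have h3 : (U * A * V).charpoly = A.charpoly := by
      rw [Matrix.charpoly_mul_comm, ← Matrix.mul_assoc, hUV, Matrix.one_mul]
    rw [h3, h2] at h1
    exact (mul_left_cancel₀ (by simp) h1).symm
  · unfold sumPrincipalMinors
    rw [Finset.powersetCard_eq_empty.2 (by simpa using hk)]; simp

/-- the Garding cone -/
def Gam (n k : ℕ) (A : Matrix (Fin n) (Fin n) ℝ) : Prop :=
  A.IsHermitian ∧ ∀ j, 1 ≤ j → j ≤ k → 0 < sumPrincipalMinors n j A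

theorem gam_rank_one (n k : ℕ) (A : Matrix (Fin n) (Fin n) ℝ) (hA : Gam n k A) (v : Fin n → ℝ) :
    ∀ j, 1 ≤ j → j ≤ k → sumPrincipalMinors n j A ≤ sumPrincipalMinors n j (A + Matrix.vecMulVec v v) := by
  intro j hj hjk
  obtain ⟨hH, hP⟩ := hA
  set U : Matrix (Fin n) (Fin n) ℝ := (hH.eigenvectorUnitary : Matrix (Fin n) (Fin n) ℝ) with hU
  set d := hH.eigenvalues with hd
  have h1 : star U * U = 1 := Unitary.coe_star_mul_self hH.eigenvectorUnitary
  have h2 : U * star U = 1 := Unitary.coe_mul_star_self hH.eigenvectorUnitary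
  have hs : A = U * Matrix.diagonal d * star U := by
    have := hH.spectral_theorem
    rw [Unitary.conjStarAlgAut_apply] at this
    exact this
  have hSA : ∀ i, sumPrincipalMinors n i A = esy d Finset.univ i := by
    intro i
    rw [hs, spm_conj _ _ _ _ _ h1, spm_diag]
  set w := (star U).mulVec v with hw
  have hv : Matrix.vecMulVec v v = U * Matrix.vecMulVec w w * star U := by
    have : Matrix.vecMulVec w w = star U * Matrix.vecMulVec v v * U := by
      rw [hw, Matrix.mul_vecMulVec, Matrix.vecMulVec_mul]
      congr 1
      ext i
      simp [Matrix.mulVec, Matrix.vecMul, dotProduct, Matrix.star_apply, mul_comm]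
    rw [this, show U * (star U * Matrix.vecMulVec v v * U) * star U = (U * star U) * Matrix.vecMulVec v v * (U * star U) by simp only [Matrix.mul_assoc], h2]
    simp
  obtain ⟨j, rfl⟩ : ∃ i, j = i + 1 := ⟨j - 1, by omega⟩
  rw [hSA, show A + Matrix.vecMulVec v v = U * (Matrix.diagonal d + Matrix.vecMulVec w w) * star U by
    rw [Matrix.mul_add, Matrix.add_mul, ← hv, ← hs], spm_conj _ _ _ _ _ h1, spm_diag_rank_one]
  have : 0 ≤ ∑ i, w i ^ 2 * esy d (Finset.univ.erase i) j := by
    refine Finset.sum_nonneg fun i _ => mul_nonneg (sq_nonneg _) (le_of_lt ?_)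
    refine gamma_erase d _ i (Finset.mem_univ i) k ?_ j (by omega)
    intro l hl hlk
    rw [← hSA]; exact hP l hl hlk
  linarith

theorem gam_mono (n k : ℕ) (A P : Matrix (Fin n) (Fin n) ℝ) (hA : Gam n k A) (hP : P.PosSemidef) :
    ∀ j, 1 ≤ j → j ≤ k → sumPrincipalMinors n j A ≤ sumPrincipalMinors n j (A + P) := by
  obtain ⟨m, v, rfl⟩ := Matrix.posSemidef_iff_eq_sum_vecMulVec.1 hP
  clear hP
  suffices h : Gam n k (A + ∑ i, Matrix.vecMulVec (v i) (star (v i))) ∧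
    ∀ j, 1 ≤ j → j ≤ k → sumPrincipalMinors n j A ≤
      sumPrincipalMinors n j (A + ∑ i, Matrix.vecMulVec (v i) (star (v i))) from h.2
  induction m with
  | zero => simpa using hA
  | succ m ih =>
    obtain ⟨h1, h2⟩ := ih (fun i => v i.castSucc)
    rw [Fin.sum_univ_castSucc, ← add_assoc]
    set B := A + ∑ i : Fin m, Matrix.vecMulVec (v i.castSucc) (star (v i.castSucc))
    have h3 := gam_rank_one n k B h1 (v (Fin.last m))
    have hst : star (v (Fin.last m)) = v (Fin.last m) := by ext; simp
    rw [hst]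
    refine ⟨⟨h1.1.add ?_, fun j hj hjk => (h1.2 j hj hjk).trans_le (h3 j hj hjk)⟩,
      fun j hj hjk => (h2 j hj hjk).trans (h3 j hj hjk)⟩
    ext i j
    simp [Matrix.vecMulVec_apply, mul_comm]

open scoped Matrix
local notation "EE" n => EuclideanSpace ℝ (Fin n)

theorem second_deriv_nonneg {E : Type*} [NormedAddCommGroup E] [NormedSpace ℝ E] (f : E → ℝ) (x : E)
    (hf : ContDiffAt ℝ 2 f x) (hm : IsLocalMin f x) (v : E) :
    0 ≤ fderiv ℝ (fderiv ℝ f) x v v := by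
  set g : ℝ → ℝ := fun s => f (x + s • v) with hg
  have hl : Continuous (fun s : ℝ => x + s • v) := by fun_prop
  have hl0 : Tendsto (fun s : ℝ => x + s • v) (nhds 0) (nhds x) := by
    have := hl.tendsto 0
    simpa using this
  have hev : ∀ᶠ y in nhds x, ContDiffAt ℝ 2 f y := hf.eventually (by simp)
  have hd : ∀ᶠ s in nhds (0:ℝ), deriv g s = fderiv ℝ f (x + s • v) v := by
    filter_upwards [hl0.eventually hev] with s hs
    have h1 : HasFDerivAt f (fderiv ℝ f (x + s • v)) (x + s • v) :=
      (hs.differentiableAt (by simp)).hasFDerivAt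
    have h2 : HasDerivAt (fun s : ℝ => x + s • v) v s := by
      simpa using ((hasDerivAt_id s).smul_const v).const_add x
    exact (h1.comp_hasDerivAt s h2).deriv
  have hdd : deriv (deriv g) 0 = fderiv ℝ (fderiv ℝ f) x v v := by
    rw [EventuallyEq.deriv_eq hd]
    have h0 : ContDiffAt ℝ 1 (fderiv ℝ f) x := hf.fderiv_right (by norm_num)
    have h1 : HasFDerivAt (fderiv ℝ f) (fderiv ℝ (fderiv ℝ f) x) (x + (0:ℝ) • v) := by
      simpa using (h0.differentiableAt (by simp)).hasFDerivAt
    have h2 : HasDerivAt (fun s : ℝ => x + s • v) v 0 := by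
      simpa using ((hasDerivAt_id (0:ℝ)).smul_const v).const_add x
    have h3 := (h1.comp_hasDerivAt 0 h2)
    exact (h3.clm_apply (hasDerivAt_const 0 v)).deriv.trans (by simp)
  rw [← hdd]
  by_contra hneg
  push Not at hneg
  have hgmin : IsLocalMin g 0 := by
    have := hl0.eventually hm
    simpa [IsLocalMin, IsMinFilter, hg] using this
  have hgc : ContinuousAt g 0 := by
    have : ContinuousAt f (x + (0:ℝ) • v) := by simpa using hf.continuousAt
    exact ContinuousAt.comp (f := fun s : ℝ => x + s • v) this hl.continuousAt
  have hgmax : IsLocalMax g 0 := isLocalMax_of_deriv_deriv_neg hneg hgmin.deriv_eq_zero hgc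
  have hconst : g =ᶠ[nhds 0] fun _ => g 0 := by
    filter_upwards [hgmin, hgmax] with s h1 h2
    exact le_antisymm h2 h1
  have h2 : deriv g =ᶠ[nhds 0] fun _ => 0 := by
    filter_upwards [hconst.deriv] with s hs
    simpa using hs
  rw [h2.deriv_eq] at hneg
  simp at hneg

theorem hess_apply (n : ℕ) (f : (EE n) → ℝ) (x : EE n) (i j : Fin n) :
    hessianMatrix n f x i j =
      fderiv ℝ (fderiv ℝ f) x (EuclideanSpace.single i 1) (EuclideanSpace.single j 1) := by
  simp [hessianMatrix, iteratedFDeriv_two_apply]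

theorem hess_herm (n : ℕ) (f : (EE n) → ℝ) (x : EE n) (hf : ContDiffAt ℝ 2 f x) :
    (hessianMatrix n f x).IsHermitian := by
  have h := hf.isSymmSndFDerivAt (by simp)
  ext i j
  simp only [Matrix.conjTranspose_apply, hess_apply, star_trivial]
  exact h.eq _ _

theorem sum_single (n : ℕ) (v : Fin n → ℝ) :
    WithLp.toLp 2 v = ∑ i, v i • (EuclideanSpace.single i (1:ℝ) : EE n) := by
  ext j
  simp [Finset.sum_apply, Pi.single_apply]

theorem hess_psd (n : ℕ) (f : (EE n) → ℝ) (x : EE n) (hf : ContDiffAt ℝ 2 f x)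
    (hm : IsLocalMin f x) : (hessianMatrix n f x).PosSemidef := by
  refine Matrix.PosSemidef.of_dotProduct_mulVec_nonneg (hess_herm n f x hf) fun v => ?_
  have h := second_deriv_nonneg f x hf hm (WithLp.toLp 2 v)
  rw [sum_single] at h
  suffices hh : star v ⬝ᵥ (hessianMatrix n f x).mulVec v = fderiv ℝ (fderiv ℝ f) x
      (∑ i, v i • (EuclideanSpace.single i (1:ℝ) : EE n))
      (∑ i, v i • (EuclideanSpace.single i (1:ℝ) : EE n)) by rw [hh]; exact h
  simp only [map_sum, map_smul, _root_.sum_apply, _root_.smul_apply, dotProduct, Matrix.mulVec,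
    hess_apply, Finset.mul_sum, smul_eq_mul, star_trivial]
  rw [Finset.sum_comm]
  refine Finset.sum_congr rfl fun i _ => Finset.sum_congr rfl fun j _ => ?_
  ring

theorem hess_sub (n : ℕ) (f g : (EE n) → ℝ) (x : EE n) (hf : ContDiffAt ℝ 2 f x)
    (hg : ContDiffAt ℝ 2 g x) :
    hessianMatrix n (fun y => f y - g y) x = hessianMatrix n f x - hessianMatrix n g x := by
  ext i j
  have := iteratedFDeriv_sub_apply hf hg
  simp only [hessianMatrix, Matrix.of_apply, Matrix.sub_apply]
  rw [← _root_.sub_apply, ← this]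
  rfl

theorem hess_smul (n : ℕ) (f : (EE n) → ℝ) (x : EE n) (hf : ContDiffAt ℝ 2 f x) (c : ℝ) :
    hessianMatrix n (fun y => c * f y) x = c • hessianMatrix n f x := by
  ext i j
  have := iteratedFDeriv_const_smul_apply (a := c) hf
  simp only [hessianMatrix, Matrix.of_apply, Matrix.smul_apply]
  rw [← _root_.smul_apply, ← this]
  rfl

theorem spm_smul (n k : ℕ) (A : Matrix (Fin n) (Fin n) ℝ) (c : ℝ) :
    sumPrincipalMinors n k (c • A) = c ^ k * sumPrincipalMinors n k A := by
  unfold sumPrincipalMinors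
  rw [Finset.mul_sum]
  refine Finset.sum_congr rfl fun s hs => ?_
  rw [Matrix.submatrix_smul, Pi.smul_apply, Pi.smul_apply, Matrix.det_smul, Fintype.card_coe,
    (Finset.mem_powersetCard.1 hs).2]

theorem Gam.smul {n k : ℕ} {A : Matrix (Fin n) (Fin n) ℝ} (hA : Gam n k A) {c : ℝ} (hc : 0 < c) :
    Gam n k (c • A) := by
  refine ⟨?_, fun j hj hjk => ?_⟩
  · have := hA.1
    unfold Matrix.IsHermitian at *
    rw [Matrix.conjTranspose_smul, this]; simp
  · rw [spm_smul]; exact mul_pos (pow_pos hc j) (hA.2 j hj hjk)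

theorem touch (n k : ℕ) (hk : 1 ≤ k) (f g : (EE n) → ℝ) (x : EE n) (hf : ContDiffAt ℝ 2 f x)
    (hg : ContDiffAt ℝ 2 g x) (hm : IsLocalMin (fun y => f y - g y) x)
    (hG : Gam n k (hessianMatrix n g x)) : SkHess n k g x ≤ SkHess n k f x := by
  have h1 := hess_psd n _ x (hf.sub hg) hm
  have h2 := hess_sub n f g x hf hg
  have h3 := gam_mono n k _ _ hG h1 k hk le_rfl
  rw [show (hessianMatrix n (fun y => f y - g y) x) = hessianMatrix n f x - hessianMatrix n g x from h2] at h3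
  simpa [SkHess] using h3

theorem hess_comp (n : ℕ) (f : (EE n) → ℝ) (x : EE n) (L : (EE n) ≃L[ℝ] (EE n)) :
    ∃ M : Matrix (Fin n) (Fin n) ℝ, (∀ i j, M i j = L (EuclideanSpace.single j 1) i) ∧
      hessianMatrix n (fun y => f (L y)) x = M.transpose * hessianMatrix n f (L x) * M := by
  refine ⟨Matrix.of fun i j => L (EuclideanSpace.single j 1) i, fun i j => rfl, ?_⟩
  have h := L.iteratedFDerivWithin_comp_right f uniqueDiffOn_univ (x := x) (by simp) 2
  simp only [Set.preimage_univ, iteratedFDerivWithin_univ] at h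
  ext i j
  have h1 : hessianMatrix n (fun y => f (L y)) x i j =
    fderiv ℝ (fderiv ℝ f) (L x) (L (EuclideanSpace.single i 1)) (L (EuclideanSpace.single j 1)) := by
    have : hessianMatrix n (fun y => f (L y)) x i j = iteratedFDeriv ℝ 2 (f ∘ L) x ![EuclideanSpace.single i (1 : ℝ), EuclideanSpace.single j (1 : ℝ)] := rfl
    rw [this, h]
    simp [iteratedFDeriv_two_apply]
  rw [h1]
  have hs : ∀ v : EE n, v = ∑ i, v i • (EuclideanSpace.single i (1:ℝ) : EE n) := fun v => sum_single n v
  rw [hs (L (EuclideanSpace.single i 1)), hs (L (EuclideanSpace.single j 1))]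
  simp only [map_sum, map_smul, _root_.sum_apply, _root_.smul_apply, Matrix.mul_apply,
    Finset.sum_mul, Matrix.transpose_apply, Matrix.of_apply, hess_apply, smul_eq_mul, Finset.mul_sum]
  refine Finset.sum_congr rfl fun i _ => Finset.sum_congr rfl fun j _ => ?_
  ring

theorem SkHess_rot (n k : ℕ) (f : (EE n) → ℝ) (x : EE n) (L : (EE n) ≃ₗᵢ[ℝ] (EE n)) :
    SkHess n k (fun y => f (L y)) x = SkHess n k f (L x) := by
  obtain ⟨M, hM, h⟩ := hess_comp n f x L.toContinuousLinearEquiv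
  unfold SkHess
  have h' : hessianMatrix n (fun y => f (L y)) x = M.transpose * hessianMatrix n f (L x) * M := h
  have h1 : M.transpose * M = 1 := by
    ext i j
    have := L.inner_map_map (EuclideanSpace.single i 1) (EuclideanSpace.single j 1)
    rw [EuclideanSpace.inner_single_left, PiLp.inner_apply] at this
    simp only [map_one, one_mul, PiLp.single_apply] at this
    simp only [Matrix.mul_apply, Matrix.transpose_apply, hM, Matrix.one_apply]
    rw [← this]
    refine Finset.sum_congr rfl fun l _ => ?_
    simp [mul_comm]
  rw [h', spm_conj]
  exact mul_eq_one_comm.1 h1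

theorem hess_scale (n : ℕ) (f : (EE n) → ℝ) (x : EE n) (c : ℝ) (hc : c ≠ 0) :
    hessianMatrix n (fun y => f (c • y)) x = c ^ 2 • hessianMatrix n f (c • x) := by
  obtain ⟨M, hM, h⟩ := hess_comp n f x (ContinuousLinearEquiv.smulLeft (Units.mk0 c hc))
  have h' : hessianMatrix n (fun y => f (c • y)) x = M.transpose * hessianMatrix n f (c • x) * M := h
  have : M = c • 1 := by
    ext i j
    rw [hM]
    change (c • (EuclideanSpace.single j (1:ℝ) : EE n)) i = _
    simp [Matrix.one_apply]
  rw [h', this]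
  simp [smul_smul, pow_two]

theorem clb (n : ℕ) {R : ℝ} (hR : 0 < R) :
    closure (Metric.ball (0 : EE n) R) = Metric.closedBall 0 R := closure_ball _ hR.ne'

theorem frb (n : ℕ) {R : ℝ} (hR : 0 < R) :
    frontier (Metric.ball (0 : EE n) R) = Metric.sphere 0 R := frontier_ball _ hR.ne'

theorem star_rot (n k : ℕ) {R : ℝ} (hR : 0 < R) (θ : (EE n) → ℝ)
    (hθ : IsStarSolution n k (Metric.ball (0 : EE n) R) θ) (L : (EE n) ≃ₗᵢ[ℝ] (EE n)) :
    IsStarSolution n k (Metric.ball (0 : EE n) R) (fun y => θ (L y)) := by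
  obtain ⟨⟨h1, h2, h3⟩, h4, h5, h6⟩ := hθ
  rw [clb n hR] at h2
  rw [frb n hR] at h5
  have hb : ∀ x ∈ Metric.ball (0 : EE n) R, L x ∈ Metric.ball (0 : EE n) R := by
    intro x hx; simpa using hx
  refine ⟨⟨?_, ?_, ?_⟩, ?_, ?_, ?_⟩
  · exact h1.comp L.contDiff.contDiffOn hb
  · rw [clb n hR]
    exact h2.comp L.continuous.continuousOn (by intro x hx; simpa using hx)
  · intro j hj hjk x hx
    rw [SkHess_rot]; exact h3 j hj hjk _ (hb x hx)
  · intro x hx; exact h4 _ (hb x hx)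
  · intro x hx
    rw [frb n hR] at hx
    exact h5 _ (by simpa using hx)
  · intro x hx
    rw [SkHess_rot]; exact h6 _ (hb x hx)

theorem maxp (n : ℕ) (r s T : ℝ) (z : ℝ → (EE n) → ℝ)
    (hc : ContinuousOn (fun p : ℝ × (EE n) => z p.1 p.2) (Icc s T ×ˢ Metric.closedBall (0 : EE n) r))
    (h0 : ∀ x ∈ Metric.closedBall (0 : EE n) r, z s x ≤ 0)
    (hb : ∀ t ∈ Icc s T, ∀ x ∈ Metric.sphere (0 : EE n) r, z t x ≤ 0)
    (hi : ∀ t ∈ Ioc s T, ∀ x ∈ Metric.ball (0 : EE n) r, IsLocalMax (z t) x →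
      ∃ d ≤ 0, HasDerivAt (fun τ => z τ x) d t) :
    ∀ t ∈ Icc s T, ∀ x ∈ Metric.closedBall (0 : EE n) r, z t x ≤ 0 := by
  intro t1 ht1 x1 hx1
  by_contra hpos
  push Not at hpos
  have hT : 0 ≤ T - s := by linarith [ht1.1, ht1.2]
  set ε := z t1 x1 / (T - s + 1) with hε
  have hε0 : 0 < ε := by positivity
  have hεT : ε * (T - s + 1) = z t1 x1 := by rw [hε]; field_simp
  have hK : IsCompact (Icc s T ×ˢ Metric.closedBall (0 : EE n) r) :=
    isCompact_Icc.prod (isCompact_closedBall _ _)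
  obtain ⟨⟨t0, x0⟩, hmem, hmax⟩ := hK.exists_isMaxOn ⟨(t1, x1), ht1, hx1⟩
    (f := fun p : ℝ × (EE n) => z p.1 p.2 - ε * (p.1 - s)) (hc.sub (by fun_prop))
  obtain ⟨ht0, hx0⟩ := hmem
  simp only at ht0 hx0
  have hmax' : ∀ t ∈ Icc s T, ∀ x ∈ Metric.closedBall (0 : EE n) r,
      z t x - ε * (t - s) ≤ z t0 x0 - ε * (t0 - s) := fun t ht x hx => hmax (a := (t, x)) ⟨ht, hx⟩
  have hv : 0 < z t0 x0 - ε * (t0 - s) := by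
    have := hmax' t1 ht1 x1 hx1
    nlinarith [ht1.2]
  have hv2 : 0 < z t0 x0 := by nlinarith [ht0.1]
  have hts : s < t0 := by
    rcases ht0.1.eq_or_lt with h | h
    · subst h; linarith [h0 x0 hx0]
    · exact h
  have hxb : x0 ∈ Metric.ball (0 : EE n) r := by
    rcases (Metric.mem_closedBall.1 hx0).eq_or_lt with h | h
    · linarith [hb t0 ht0 x0 h]
    · exact h
  have hloc : IsLocalMax (z t0) x0 := by
    filter_upwards [Metric.isOpen_ball.mem_nhds hxb] with y hy
    linarith [hmax' t0 ht0 y (Metric.ball_subset_closedBall hy)]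
  obtain ⟨d, hd, hder⟩ := hi t0 ⟨hts, ht0.2⟩ x0 hxb hloc
  have hder2 : HasDerivAt (fun τ => z τ x0 - ε * (τ - s)) (d - ε * 1) t0 :=
    hder.sub (((hasDerivAt_id t0).sub_const s).const_mul ε)
  have hsl := (hasDerivAt_iff_tendsto_slope.1 hder2).mono_left
    (nhdsWithin_mono t0 (show Iio t0 ⊆ {t0}ᶜ from fun a ha => ne_of_lt ha))
  have : 0 ≤ d - ε * 1 := by
    refine ge_of_tendsto hsl ?_
    filter_upwards [Ioo_mem_nhdsLT hts] with τ hτ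
    rw [slope_def_field]
    refine div_nonneg_of_nonpos ?_ (by linarith [hτ.2])
    have := hmax' τ ⟨hτ.1.le, hτ.2.le.trans ht0.2⟩ x0 hx0
    linarith
  linarith

section
variable {n k : ℕ} {R : ℝ} {u : ℝ → (EE n) → ℝ}

theorem u_cont (hR : 0 < R) (hu : IsSolutionP n k (Metric.ball (0 : EE n) R) u)
    (x : EE n) (hx : x ∈ Metric.closedBall (0 : EE n) R) :
    ContinuousOn (fun t => u t x) (Ioi 0) := by
  rcases (Metric.mem_closedBall.1 hx).eq_or_lt with h | h
  · have : ∀ t ∈ Ioi (0:ℝ), u t x = 0 := fun t ht => hu.2.2 t (le_of_lt ht) x (by rw [frb n hR]; exact h)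
    exact continuousOn_const.congr this
  · exact fun t ht => (hu.1 t ht x h).continuousAt.continuousWithinAt

theorem u_mono (hk : 1 ≤ k) (hR : 0 < R) (hu : IsSolutionP n k (Metric.ball (0 : EE n) R) u)
    (x : EE n) (hx : x ∈ Metric.closedBall (0 : EE n) R) :
    MonotoneOn (fun t => u t x) (Ioi 0) := by
  rcases (Metric.mem_closedBall.1 hx).eq_or_lt with h | h
  · have : ∀ t ∈ Ioi (0:ℝ), u t x = 0 := fun t ht => hu.2.2 t (le_of_lt ht) x (by rw [frb n hR]; exact h)
    intro a ha b hb _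
    simp only [this a ha, this b hb, le_refl]
  · refine monotoneOn_of_deriv_nonneg (convex_Ioi 0) (u_cont hR hu x hx) ?_ ?_
    · rw [interior_Ioi]
      exact fun t ht => (hu.1 t ht x h).differentiableAt.differentiableWithinAt
    · rw [interior_Ioi]
      intro t ht
      rw [(hu.1 t ht x h).deriv]
      exact ((hu.2.1 t (le_of_lt ht)).2.2 k hk le_rfl x h).le

theorem u_joint (hk : 1 ≤ k) (hR : 0 < R) (hu : IsSolutionP n k (Metric.ball (0 : EE n) R) u) :
    ContinuousOn (fun p : ℝ × (EE n) => u p.1 p.2) (Ioi 0 ×ˢ Metric.closedBall (0 : EE n) R) := by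
  rintro ⟨t0, x0⟩ ⟨ht0, hx0⟩
  simp only at ht0 hx0
  have hslice : ∀ t, 0 < t → ContinuousWithinAt (u t) (Metric.closedBall (0 : EE n) R) x0 := by
    intro t ht
    have := (hu.2.1 t ht.le).2.1
    rw [clb n hR] at this
    exact this x0 hx0
  have htc : ContinuousAt (fun t => u t x0) t0 :=
    (u_cont hR hu x0 hx0).continuousAt (Ioi_mem_nhds ht0)
  rw [ContinuousWithinAt, nhdsWithin_prod_eq, nhdsWithin_eq_nhds.2 (Ioi_mem_nhds ht0)]
  refine tendsto_order.2 ⟨fun a ha => ?_, fun a ha => ?_⟩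
  · obtain ⟨t', h1, h2, h3⟩ : ∃ t', a < u t' x0 ∧ 0 < t' ∧ t' < t0 := by
      have e1 : ∀ᶠ t in nhdsWithin t0 (Iio t0), a < u t x0 :=
        (htc.eventually (lt_mem_nhds ha)).filter_mono nhdsWithin_le_nhds
      obtain ⟨t', h1, h2⟩ := (e1.and (Ioo_mem_nhdsLT (show (0:ℝ) < t0 from ht0))).exists
      exact ⟨t', h1, h2.1, h2.2⟩
    have e2 : ∀ᶠ x in nhdsWithin x0 (Metric.closedBall (0 : EE n) R), a < u t' x ∧ x ∈ Metric.closedBall (0 : EE n) R :=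
      ((hslice t' h2).eventually (lt_mem_nhds h1)).and self_mem_nhdsWithin
    filter_upwards [(lt_mem_nhds h3 : ∀ᶠ t in nhds t0, t' < t).prod_mk e2] with p hp
    exact hp.2.1.trans_le (u_mono hk hR hu p.2 hp.2.2 h2 (h2.trans hp.1) hp.1.le)
  · obtain ⟨t', h1, h3⟩ : ∃ t', u t' x0 < a ∧ t0 < t' := by
      have e1 : ∀ᶠ t in nhdsWithin t0 (Ioi t0), u t x0 < a :=
        (htc.eventually (gt_mem_nhds ha)).filter_mono nhdsWithin_le_nhds
      obtain ⟨t', h1, h2⟩ := (e1.and self_mem_nhdsWithin).exists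
      exact ⟨t', h1, h2⟩
    have h2 : 0 < t' := lt_trans ht0 h3
    have e2 : ∀ᶠ x in nhdsWithin x0 (Metric.closedBall (0 : EE n) R), u t' x < a ∧ x ∈ Metric.closedBall (0 : EE n) R :=
      ((hslice t' h2).eventually (gt_mem_nhds h1)).and self_mem_nhdsWithin
    filter_upwards [((gt_mem_nhds h3 : ∀ᶠ t in nhds t0, t < t').and (lt_mem_nhds (show (0:ℝ) < t0 from ht0))).prod_mk e2] with p hp
    exact (u_mono hk hR hu p.2 hp.2.2 hp.1.2 h2 hp.1.1.le).trans_lt hp.2.1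

theorem adm_contDiffAt {Ω : Set (EE n)} (hΩ : IsOpen Ω) {f : (EE n) → ℝ} (hf : KAdmissible n k Ω f)
    {x : EE n} (hx : x ∈ Ω) : ContDiffAt ℝ 2 f x :=
  hf.1.contDiffAt (hΩ.mem_nhds hx)

theorem adm_gam {Ω : Set (EE n)} (hΩ : IsOpen Ω) {f : (EE n) → ℝ} (hf : KAdmissible n k Ω f)
    {x : EE n} (hx : x ∈ Ω) : Gam n k (hessianMatrix n f x) :=
  ⟨hess_herm n f x (adm_contDiffAt hΩ hf hx), fun j hj hjk => hf.2.2 j hj hjk x hx⟩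

theorem adm_neg (hk : 1 ≤ k) (hR : 0 < R) (f : (EE n) → ℝ)
    (hf : KAdmissible n k (Metric.ball (0 : EE n) R) f)
    (h0 : ∀ x ∈ Metric.sphere (0 : EE n) R, f x = 0) :
    ∀ x ∈ Metric.ball (0 : EE n) R, f x < 0 := by
  have hno : ∀ x ∈ Metric.ball (0 : EE n) R, ¬ IsLocalMax f x := by
    intro x hx hm
    have hG := adm_gam Metric.isOpen_ball hf hx
    have ht := touch n 1 le_rfl (fun _ => 0) f x contDiffAt_const
      (adm_contDiffAt Metric.isOpen_ball hf hx) (by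
        filter_upwards [hm] with y hy; simpa using hy)
      ⟨hG.1, fun j hj hj1 => hG.2 j hj (hj1.trans hk)⟩
    have h1 : 0 < SkHess n 1 f x := hf.2.2 1 le_rfl hk x hx
    have h2 : SkHess n 1 (fun _ : EE n => (0:ℝ)) x = 0 := by
      have : hessianMatrix n (fun _ : EE n => (0:ℝ)) x = (0:ℝ) • 1 := by
        ext i j; rw [hess_apply]; simp
      rw [SkHess, this, spm_smul]; simp
    linarith
  have hc := hf.2.1
  rw [clb n hR] at hc
  obtain ⟨x0, hx0, hmax⟩ := (isCompact_closedBall (0 : EE n) R).exists_isMaxOn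
    ⟨0, by simp [hR.le]⟩ hc
  have hle : ∀ y ∈ Metric.closedBall (0 : EE n) R, f y ≤ f x0 := fun y hy => hmax hy
  have hz : f x0 = 0 := by
    rcases (Metric.mem_closedBall.1 hx0).eq_or_lt with h | h
    · exact h0 x0 h
    · exfalso
      refine hno x0 h ?_
      filter_upwards [Metric.isOpen_ball.mem_nhds (show x0 ∈ Metric.ball (0 : EE n) R from h)] with y hy
      exact hle y (Metric.ball_subset_closedBall hy)
  intro x hx
  refine lt_of_le_of_ne (hz ▸ hle x (Metric.ball_subset_closedBall hx)) fun h => hno x hx ?_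
  filter_upwards [Metric.isOpen_ball.mem_nhds hx] with y hy
  have := hle y (Metric.ball_subset_closedBall hy)
  linarith
end

theorem pow_exists (p : ℝ) (hp : 0 < p) (K : ℝ) (hK : 0 < K) : ∃ η : ℝ, 0 < η ∧ η ^ (-p) = K := by
  refine ⟨K ^ (-(1/p)), Real.rpow_pos_of_pos hK _, ?_⟩
  rw [← Real.rpow_mul hK.le, show -(1/p) * -p = 1 by field_simp, Real.rpow_one]

theorem fder (k : ℕ) (hk : 2 ≤ k) (c t : ℝ) (ht : 0 < c + t) :
    HasDerivAt (fun τ : ℝ => (c + τ) ^ (-(1 / ((k:ℝ) - 1))))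
      (-(((c + t) ^ (-(1 / ((k:ℝ) - 1)))) ^ k / ((k:ℝ) - 1))) t := by
  have hk' : (0:ℝ) < (k:ℝ) - 1 := by
    have : (2:ℝ) ≤ k := by exact_mod_cast hk
    linarith
  have h1 : HasDerivAt (fun τ : ℝ => c + τ) 1 t := (hasDerivAt_id t).const_add c
  have h2 := h1.rpow_const (p := -(1 / ((k:ℝ) - 1))) (Or.inl ht.ne')
  convert h2 using 1
  rw [← Real.rpow_natCast, ← Real.rpow_mul ht.le]
  rw [show -(1 / ((k:ℝ) - 1)) * k = -(1 / ((k:ℝ) - 1)) - 1 by field_simp; ring]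
  ring

section
variable {n k : ℕ} {R : ℝ} {u : ℝ → (EE n) → ℝ} {θ : (EE n) → ℝ}

theorem lower_bound (hk : 2 ≤ k) (hR : 0 < R)
    (hu : IsSolutionP n k (Metric.ball (0 : EE n) R) u)
    (hθ : IsStarSolution n k (Metric.ball (0 : EE n) R) θ) (t : ℝ) (ht : 1 < t)
    (x : EE n) (hx : x ∈ Metric.closedBall (0 : EE n) R) :
    (-1 + t) ^ (-(1 / ((k:ℝ) - 1))) * θ x ≤ u t x := by
  have hk' : (0:ℝ) < (k:ℝ) - 1 := by
    have : (2:ℝ) ≤ k := by exact_mod_cast hk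
    linarith
  set p := 1 / ((k:ℝ) - 1) with hp
  have hp0 : 0 < p := by positivity
  obtain ⟨hadm, hneg, hbd, heq⟩ := hθ
  have hθc := hadm.2.1
  rw [clb n hR] at hθc
  rw [frb n hR] at hbd
  have hθle : ∀ y ∈ Metric.closedBall (0 : EE n) R, θ y ≤ 0 := by
    intro y hy
    rcases (Metric.mem_closedBall.1 hy).eq_or_lt with h | h
    · exact (hbd y h).le
    · exact (hneg y h).le
  refine le_of_forall_pos_sub_le fun δ hδ => ?_
  -- initial data
  have hu1 := (hu.2.1 1 zero_le_one).2.1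
  rw [clb n hR] at hu1
  have hub := hu.2.2 1 zero_le_one
  rw [frb n hR] at hub
  obtain ⟨K, hK0, hK⟩ : ∃ K : ℝ, 0 < K ∧ ∀ y ∈ Metric.closedBall (0 : EE n) R, K * θ y - δ ≤ u 1 y := by
    set S := Metric.closedBall (0 : EE n) R ∩ (u 1) ⁻¹' (Iic (-δ)) with hS
    have hSc : IsCompact S := (isCompact_closedBall _ _).of_isClosed_subset
      (hu1.preimage_isClosed_of_isClosed Metric.isClosed_closedBall isClosed_Iic) inter_subset_left
    have hSb : ∀ y ∈ S, θ y < 0 := by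
      intro y hy
      rcases (Metric.mem_closedBall.1 hy.1).eq_or_lt with h | h
      · have h1 := hub y h
        have h2 : u 1 y ≤ -δ := hy.2
        linarith
      · exact hneg y h
    have hcont : ContinuousOn (fun y => u 1 y / θ y) S :=
      (hu1.mono inter_subset_left).div (hθc.mono inter_subset_left) fun y hy => (hSb y hy).ne
    obtain ⟨C, hC⟩ := hSc.bddAbove_image hcont
    refine ⟨max C 1, by positivity, fun y hy => ?_⟩
    by_cases h : u 1 y ≤ -δ
    · have hyS : y ∈ S := ⟨hy, h⟩
      have h1 : u 1 y / θ y ≤ max C 1 := (hC ⟨y, hyS, rfl⟩).trans (le_max_left _ _)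
      rw [div_le_iff_of_neg (hSb y hyS)] at h1
      linarith
    · push Not at h
      have : max C 1 * θ y ≤ 0 := mul_nonpos_of_nonneg_of_nonpos (by positivity) (hθle y hy)
      linarith
  obtain ⟨η, hη, hηK⟩ := pow_exists p hp0 K hK0
  have hmp := maxp n R 1 t (fun τ y => ((-1 + η) + τ) ^ (-p) * θ y - δ - u τ y) ?_ ?_ ?_ ?_ t ⟨ht.le, le_rfl⟩ x hx
  · have h1 : ((-1 + η) + t) ^ (-p) ≤ (-1 + t) ^ (-p) :=
      Real.rpow_le_rpow_of_nonpos (by linarith) (by linarith) (by linarith)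
    have h2 := mul_le_mul_of_nonpos_right h1 (hθle x hx)
    linarith
  · refine (ContinuousOn.sub (ContinuousOn.mul ?_ ?_) continuousOn_const).sub ?_
    · refine ContinuousOn.rpow_const (by fun_prop) ?_
      rintro ⟨τ, y⟩ ⟨h1, _⟩
      left
      have := h1.1
      simp only at this ⊢
      intro h; linarith
    · exact hθc.comp continuousOn_snd fun p hp => hp.2
    · exact (u_joint (by omega) hR hu).mono (prod_mono (fun τ hτ => lt_of_lt_of_le one_pos hτ.1) le_rfl)
  · intro y hy
    have : ((-1 + η) + 1) = η := by ring
    rw [this, hηK]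
    linarith [hK y hy]
  · intro τ hτ y hy
    have h1 := hu.2.2 τ (zero_le_one.trans hτ.1) y (by rw [frb n hR]; exact hy)
    rw [h1, hbd y hy]
    linarith
  · intro τ hτ y hy hmax
    have hτ0 : 0 < τ := one_pos.trans hτ.1
    have hpos : 0 < (-1 + η) + τ := by linarith [hτ.1]
    set F := ((-1 + η) + τ) ^ (-p) with hF
    have hF0 : 0 < F := Real.rpow_pos_of_pos hpos _
    have hcd := adm_contDiffAt Metric.isOpen_ball hadm hy
    have hH := hess_smul n θ y hcd F
    have ht := touch n k (by omega) (u τ) (fun y => F * θ y) y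
      (adm_contDiffAt Metric.isOpen_ball (hu.2.1 τ hτ0.le) hy) (contDiffAt_const.mul hcd)
      (by filter_upwards [hmax] with w hw; linarith)
      (by rw [hH]; exact (adm_gam Metric.isOpen_ball hadm hy).smul hF0)
    have hS : SkHess n k (fun y => F * θ y) y = F ^ k * (-θ y / ((k:ℝ) - 1)) := by
      rw [SkHess, hH, spm_smul, ← heq y hy]; rfl
    rw [hS] at ht
    have hd := (((fder k hk (-1 + η) τ hpos).mul_const (θ y)).sub_const δ).sub (hu.1 τ hτ0 y hy)
    refine ⟨_, ?_, hd⟩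
    have : -(F ^ k / ((k:ℝ) - 1)) * θ y = F ^ k * (-θ y / ((k:ℝ) - 1)) := by ring
    change -(F ^ k / ((k:ℝ) - 1)) * θ y - _ ≤ 0
    rw [this]; linarith

theorem upper_bound (hk : 2 ≤ k) (hR : 0 < R)
    (hu : IsSolutionP n k (Metric.ball (0 : EE n) R) u)
    (hθ : IsStarSolution n k (Metric.ball (0 : EE n) R) θ) (ρ : ℝ) (hρ0 : 0 < ρ) (hρ1 : ρ < 1) :
    ∃ c : ℝ, ∀ t, 1 ≤ t → ∀ x ∈ Metric.closedBall (0 : EE n) (ρ * R),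
      u t x ≤ ρ ^ (2 * k) * (c + t) ^ (-(1 / ((k:ℝ) - 1))) * θ (ρ⁻¹ • x) := by
  have hk' : (0:ℝ) < (k:ℝ) - 1 := by
    have : (2:ℝ) ≤ k := by exact_mod_cast hk
    linarith
  set p := 1 / ((k:ℝ) - 1) with hp
  have hp0 : 0 < p := by positivity
  set κ := ρ ^ (2 * k) with hκ
  have hκ0 : 0 < κ := by positivity
  have hκ1 : κ ≤ 1 := pow_le_one₀ hρ0.le hρ1.le
  obtain ⟨hadm, hneg, hbd, heq⟩ := hθ
  have hθc := hadm.2.1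
  rw [clb n hR] at hθc
  rw [frb n hR] at hbd
  have hr : ρ * R < R := by nlinarith
  have hr0 : 0 < ρ * R := by positivity
  have hnorm : ∀ x : EE n, ‖ρ⁻¹ • x‖ = ρ⁻¹ * ‖x‖ := by
    intro x; rw [norm_smul, Real.norm_of_nonneg (by positivity)]
  have hsc : ∀ x ∈ Metric.closedBall (0 : EE n) (ρ * R), ρ⁻¹ • x ∈ Metric.closedBall (0 : EE n) R := by
    intro x hx
    rw [mem_closedBall_zero_iff] at hx ⊢
    rw [hnorm, inv_mul_le_iff₀ hρ0]; exact hx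
  have hscb : ∀ x ∈ Metric.ball (0 : EE n) (ρ * R), ρ⁻¹ • x ∈ Metric.ball (0 : EE n) R := by
    intro x hx
    rw [mem_ball_zero_iff] at hx ⊢
    rw [hnorm, inv_mul_lt_iff₀ hρ0]; exact hx
  have hscs : ∀ x ∈ Metric.sphere (0 : EE n) (ρ * R), ρ⁻¹ • x ∈ Metric.sphere (0 : EE n) R := by
    intro x hx
    rw [mem_sphere_zero_iff_norm] at hx ⊢
    rw [hnorm, hx]; field_simp
  have hθ'c : ContinuousOn (fun x => θ (ρ⁻¹ • x)) (Metric.closedBall (0 : EE n) (ρ * R)) :=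
    hθc.comp (by fun_prop) hsc
  have hun : ∀ t, 0 < t → ∀ x ∈ Metric.ball (0 : EE n) R, u t x < 0 := by
    intro t ht
    refine adm_neg (by omega) hR (u t) (hu.2.1 t ht.le) ?_
    have := hu.2.2 t ht.le
    rwa [frb n hR] at this
  have hsub : Metric.closedBall (0 : EE n) (ρ * R) ⊆ Metric.ball (0 : EE n) R :=
    Metric.closedBall_subset_ball hr
  have hu1 := (hu.2.1 1 zero_le_one).2.1
  rw [clb n hR] at hu1
  obtain ⟨K, hK0, hK⟩ : ∃ K : ℝ, 0 < K ∧ ∀ y ∈ Metric.closedBall (0 : EE n) (ρ * R),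
      K * (-θ (ρ⁻¹ • y)) ≤ - u 1 y := by
    have hcont : ContinuousOn (fun y => (-θ (ρ⁻¹ • y)) / (- u 1 y)) (Metric.closedBall (0 : EE n) (ρ * R)) :=
      hθ'c.neg.div (hu1.mono (hsub.trans Metric.ball_subset_closedBall)).neg
        fun y hy => by have := hun 1 one_pos y (hsub hy); linarith
    obtain ⟨C, hC⟩ := (isCompact_closedBall (0 : EE n) (ρ * R)).bddAbove_image hcont
    have hC1 : 0 < max C 1 := by positivity
    refine ⟨(max C 1)⁻¹, by positivity, fun y hy => ?_⟩
    have h1 : (-θ (ρ⁻¹ • y)) / (- u 1 y) ≤ max C 1 := (hC ⟨y, hy, rfl⟩).trans (le_max_left _ _)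
    have h2 := hun 1 one_pos y (hsub hy)
    rw [div_le_iff₀ (by linarith)] at h1
    rw [inv_mul_le_iff₀ hC1]; exact h1
  obtain ⟨c, hc0, hcK⟩ := pow_exists p hp0 K hK0
  refine ⟨c, fun t ht x hx => ?_⟩
  have hθle : ∀ y ∈ Metric.closedBall (0 : EE n) R, θ y ≤ 0 := by
    intro y hy
    rcases (Metric.mem_closedBall.1 hy).eq_or_lt with h | h
    · exact (hbd y h).le
    · exact (hneg y h).le
  have hmp := maxp n (ρ * R) 1 t (fun τ y => u τ y - κ * ((c + τ) ^ (-p) * θ (ρ⁻¹ • y))) ?_ ?_ ?_ ?_ t ⟨ht, le_rfl⟩ x hx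
  · linarith
  · refine ContinuousOn.sub ?_ (continuousOn_const.mul (ContinuousOn.mul ?_ ?_))
    · exact (u_joint (by omega) hR hu).mono (prod_mono (fun τ hτ => lt_of_lt_of_le one_pos hτ.1)
        (hsub.trans Metric.ball_subset_closedBall))
    · refine ContinuousOn.rpow_const (by fun_prop) ?_
      rintro ⟨τ, y⟩ ⟨h1, _⟩
      left
      have := h1.1
      simp only at this ⊢
      intro h; linarith
    · exact hθ'c.comp continuousOn_snd fun p hp => hp.2
  · intro y hy
    have h1 : (c + 1) ^ (-p) ≤ K := by
      rw [← hcK]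
      exact Real.rpow_le_rpow_of_nonpos hc0 (by linarith) (by linarith)
    have h0 : 0 < (c + 1) ^ (-p) := Real.rpow_pos_of_pos (by linarith) _
    have h2 : κ * (c + 1) ^ (-p) ≤ K := by nlinarith
    have h3 := mul_le_mul_of_nonneg_right h2 (neg_nonneg.2 (hθle _ (hsc y hy)))
    have h4 := hK y hy
    linarith
  · intro τ hτ y hy
    rw [hbd _ (hscs y hy)]
    have := hun τ (lt_of_lt_of_le one_pos hτ.1) y (hsub (Metric.sphere_subset_closedBall hy))
    linarith
  · intro τ hτ y hy hmax
    have hτ0 : 0 < τ := one_pos.trans hτ.1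
    have hpos : 0 < c + τ := by linarith [hτ.1]
    set F := (c + τ) ^ (-p) with hF
    have hF0 : 0 < F := Real.rpow_pos_of_pos hpos _
    have hyR : y ∈ Metric.ball (0 : EE n) R := hsub (Metric.ball_subset_closedBall hy)
    have hcd := adm_contDiffAt Metric.isOpen_ball hadm (hscb y hy)
    have hcd2 : ContDiffAt ℝ 2 (fun y => θ (ρ⁻¹ • y)) y :=
      ContDiffAt.comp y (g := θ) (f := fun y : EE n => ρ⁻¹ • y) hcd (by fun_prop)
    have hH := hess_smul n (fun y => θ (ρ⁻¹ • y)) y hcd2 (κ * F)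
    rw [hess_scale n θ y ρ⁻¹ (by positivity)] at hH
    have ht := touch n k (by omega) (fun y => (κ * F) * θ (ρ⁻¹ • y)) (u τ) y
      (contDiffAt_const.mul hcd2) (adm_contDiffAt Metric.isOpen_ball (hu.2.1 τ hτ0.le) hyR)
      (by filter_upwards [hmax] with w hw; linarith)
      (adm_gam Metric.isOpen_ball (hu.2.1 τ hτ0.le) hyR)
    have hS : SkHess n k (fun y => (κ * F) * θ (ρ⁻¹ • y)) y =
        (κ * F) ^ k * ((ρ⁻¹ ^ 2) ^ k * (-θ (ρ⁻¹ • y) / ((k:ℝ) - 1))) := by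
      rw [SkHess, hH, spm_smul, spm_smul, ← heq _ (hscb y hy)]; rfl
    have hS2 : (κ * F) ^ k * ((ρ⁻¹ ^ 2) ^ k * (-θ (ρ⁻¹ • y) / ((k:ℝ) - 1))) ≤
        κ * F ^ k * (-θ (ρ⁻¹ • y) / ((k:ℝ) - 1)) := by
      have h1 : (ρ⁻¹ ^ 2) ^ k = κ⁻¹ := by rw [hκ, ← pow_mul, inv_pow]
      have h2 : (κ * F) ^ k * (κ⁻¹ * (-θ (ρ⁻¹ • y) / ((k:ℝ) - 1))) =
          (κ ^ k * κ⁻¹) * (F ^ k * (-θ (ρ⁻¹ • y) / ((k:ℝ) - 1))) := by rw [mul_pow]; ring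
      rw [h1, h2, mul_assoc κ (F ^ k)]
      refine mul_le_mul_of_nonneg_right ?_ ?_
      · rw [← div_eq_mul_inv, div_le_iff₀ hκ0, ← pow_two]
        exact pow_le_pow_of_le_one hκ0.le hκ1 hk
      · have := hneg _ (hscb y hy)
        have : 0 ≤ -θ (ρ⁻¹ • y) / ((k:ℝ) - 1) := div_nonneg (by linarith) hk'.le
        positivity
    rw [hS] at ht
    have hd := (hu.1 τ hτ0 y hyR).sub (((fder k hk c τ hpos).mul_const (θ (ρ⁻¹ • y))).const_mul κ)
    refine ⟨_, ?_, hd⟩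
    have : κ * (-(F ^ k / ((k:ℝ) - 1)) * θ (ρ⁻¹ • y)) = κ * F ^ k * (-θ (ρ⁻¹ • y) / ((k:ℝ) - 1)) := by ring
    change _ - κ * (-(F ^ k / ((k:ℝ) - 1)) * θ (ρ⁻¹ • y)) ≤ 0
    rw [this]; linarith

theorem ratio_tendsto (p c : ℝ) :
    Tendsto (fun t : ℝ => (1 + t) ^ p * (c + t) ^ (-p)) atTop (nhds 1) := by
  have h1 : Tendsto (fun t : ℝ => 1 + (1 - c) / (c + t)) atTop (nhds (1 + 0)) :=
    tendsto_const_nhds.add (tendsto_const_nhds.div_atTop (tendsto_atTop_add_const_left _ c tendsto_id))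
  rw [add_zero] at h1
  have h2 := h1.rpow_const (p := p) (Or.inl one_ne_zero)
  rw [Real.one_rpow] at h2
  refine h2.congr' ?_
  filter_upwards [eventually_gt_atTop (-c), eventually_gt_atTop (-1)] with t ht ht1
  have h3 : 0 < c + t := by linarith
  have h4 : 0 < 1 + t := by linarith
  rw [show 1 + (1 - c) / (c + t) = (1 + t) / (c + t) by field_simp; ring,
    Real.div_rpow h4.le h3.le, Real.rpow_neg h3.le]
  rfl

theorem main_conv (hk : 2 ≤ k) (hR : 0 < R)
    (hu : IsSolutionP n k (Metric.ball (0 : EE n) R) u)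
    (hθ : IsStarSolution n k (Metric.ball (0 : EE n) R) θ) (ε₀ : ℝ) (hε₀ : 0 < ε₀) :
    ∀ᶠ t : ℝ in atTop, ∀ x ∈ Metric.closedBall (0 : EE n) R,
      |(1 + t) ^ ((1 : ℝ) / ((k : ℝ) - 1)) * u t x - θ x| ≤ ε₀ := by
  have hadm := hθ.1
  have hθc := hadm.2.1
  have hbd := hθ.2.2.1
  have hneg := hθ.2.1
  rw [clb n hR] at hθc
  rw [frb n hR] at hbd
  have hθle : ∀ y ∈ Metric.closedBall (0 : EE n) R, θ y ≤ 0 := by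
    intro y hy
    rcases (Metric.mem_closedBall.1 hy).eq_or_lt with h | h
    · exact (hbd y h).le
    · exact (hneg y h).le
  have hule : ∀ t, 0 < t → ∀ x ∈ Metric.closedBall (0 : EE n) R, u t x ≤ 0 := by
    intro t ht x hx
    have hb := hu.2.2 t ht.le
    rw [frb n hR] at hb
    rcases (Metric.mem_closedBall.1 hx).eq_or_lt with h | h
    · exact (hb x h).le
    · exact (adm_neg (by omega) hR (u t) (hu.2.1 t ht.le) hb x h).le
  obtain ⟨M, hM⟩ := (isCompact_closedBall (0 : EE n) R).exists_bound_of_continuousOn hθc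
  have hM0 : 0 ≤ M := (norm_nonneg _).trans (hM 0 (by simp [hR.le]))
  have hMl : ∀ x ∈ Metric.closedBall (0 : EE n) R, -M ≤ θ x := fun x hx => (abs_le.1 (hM x hx)).1
  obtain ⟨ε, hε0, hε1, hεM⟩ : ∃ ε : ℝ, 0 < ε ∧ ε ≤ 1 ∧ ε * (M + 1) ≤ ε₀ := by
    refine ⟨min 1 (ε₀ / (M + 1)), by positivity, min_le_left _ _, ?_⟩
    rw [← le_div_iff₀ (by positivity)]
    exact min_le_right _ _
  obtain ⟨δ, hδ0, hδ⟩ := Metric.uniformContinuousOn_iff.1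
    ((isCompact_closedBall (0 : EE n) R).uniformContinuousOn_of_continuous hθc) ε hε0
  obtain ⟨ρ, hρ0, hρ1, hρδ, hρε⟩ : ∃ ρ : ℝ, 0 < ρ ∧ ρ < 1 ∧ (1 - ρ) * R < δ ∧ 1 - ε < ρ ^ (2 * k) := by
    have c1 : Continuous (fun ρ : ℝ => (1 - ρ) * R) := by fun_prop
    have c2 : Continuous (fun ρ : ℝ => ρ ^ (2 * k)) := by fun_prop
    have e1 : ∀ᶠ ρ in nhdsWithin (1:ℝ) (Iio 1), (1 - ρ) * R < δ :=
      ((c1.tendsto 1).eventually (gt_mem_nhds (by simpa using hδ0))).filter_mono nhdsWithin_le_nhds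
    have e2 : ∀ᶠ ρ in nhdsWithin (1:ℝ) (Iio 1), 1 - ε < ρ ^ (2 * k) :=
      ((c2.tendsto 1).eventually (lt_mem_nhds (by simpa using hε0))).filter_mono nhdsWithin_le_nhds
    obtain ⟨ρ, h1, h2, h3⟩ := (e1.and (e2.and (Ioo_mem_nhdsLT (zero_lt_one (α := ℝ))))).exists
    exact ⟨ρ, h3.1, h3.2, h1, h2⟩
  obtain ⟨c, hc⟩ := upper_bound hk hR hu hθ ρ hρ0 hρ1
  set p := 1 / ((k:ℝ) - 1) with hp
  have l1 := ratio_tendsto p (-1)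
  have l2 := (ratio_tendsto p c).const_mul (ρ ^ (2 * k))
  rw [mul_one] at l2
  filter_upwards [l1.eventually (gt_mem_nhds (show (1:ℝ) < 1 + ε by linarith)),
    l2.eventually (lt_mem_nhds hρε), eventually_gt_atTop 1] with t ht1 ht2 ht x hx
  have hP : 0 < (1 + t) ^ p := Real.rpow_pos_of_pos (by linarith) _
  have hlow : θ x - ε * M ≤ (1 + t) ^ p * u t x := by
    have h1 := mul_le_mul_of_nonneg_left (lower_bound hk hR hu hθ t ht x hx) hP.le
    have h2 := mul_le_mul_of_nonpos_right ht1.le (hθle x hx)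
    have h3 := hMl x hx
    rw [← mul_assoc] at h1
    nlinarith
  have hup : (1 + t) ^ p * u t x ≤ θ x + ε * M + ε := by
    rcases le_or_gt ‖x‖ (ρ * R) with h | h
    · have hx' : x ∈ Metric.closedBall (0 : EE n) (ρ * R) := by simpa using h
      have h1 := mul_le_mul_of_nonneg_left (hc t ht.le x hx') hP.le
      have hn : ‖ρ⁻¹ • x‖ = ρ⁻¹ * ‖x‖ := by
        rw [norm_smul, Real.norm_of_nonneg (by positivity)]
      have hsx : ρ⁻¹ • x ∈ Metric.closedBall (0 : EE n) R := by
        rw [mem_closedBall_zero_iff, hn, inv_mul_le_iff₀ hρ0]; exact h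
      have hρi : 1 ≤ ρ⁻¹ := (one_le_inv₀ hρ0).2 hρ1.le
      have hd : dist (ρ⁻¹ • x) x < δ := by
        rw [dist_eq_norm, show ρ⁻¹ • x - x = (ρ⁻¹ - 1) • x by rw [sub_smul, one_smul], norm_smul,
          Real.norm_of_nonneg (by linarith)]
        refine lt_of_le_of_lt ?_ hρδ
        calc (ρ⁻¹ - 1) * ‖x‖ ≤ (ρ⁻¹ - 1) * (ρ * R) := mul_le_mul_of_nonneg_left h (by linarith)
          _ = (1 - ρ) * R := by field_simp
      have h2 := hδ _ hsx _ hx hd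
      rw [Real.dist_eq, abs_lt] at h2
      have h3 := mul_le_mul_of_nonpos_right ht2.le (hθle _ hsx)
      have h4 := hMl _ hsx
      nlinarith
    · have hx0 : 0 < ‖x‖ := lt_of_le_of_lt (by positivity) h
      have hxR : ‖x‖ ≤ R := by simpa using hx
      have hy : (R / ‖x‖) • x ∈ Metric.sphere (0 : EE n) R := by
        rw [mem_sphere_zero_iff_norm, norm_smul, Real.norm_of_nonneg (by positivity)]
        field_simp
      have hd : dist ((R / ‖x‖) • x) x < δ := by
        have h1R : 1 ≤ R / ‖x‖ := (one_le_div hx0).2 hxR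
        rw [dist_eq_norm, show (R / ‖x‖) • x - x = (R / ‖x‖ - 1) • x by rw [sub_smul, one_smul], norm_smul,
          Real.norm_of_nonneg (by linarith)]
        have : (R / ‖x‖ - 1) * ‖x‖ = R - ‖x‖ := by field_simp
        rw [this]; linarith
      have h2 := hδ _ (Metric.sphere_subset_closedBall hy) _ hx hd
      rw [hbd _ hy, Real.dist_eq, abs_lt] at h2
      have h3 := mul_nonpos_of_nonneg_of_nonpos hP.le (hule t (by linarith) x hx)
      nlinarith
  rw [abs_le]
  constructor <;> nlinarith
end


/-- on a ball, the (unique) stationary profile `θ` is radially symmetric and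
`(1+t)^{1/(k-1)} u(t,·)` converges uniformly on `B̄` to `θ` as `t → ∞`. -/
theorem stmt_9 (n k : ℕ) (hn : 2 ≤ n) (hk : 2 ≤ k) (hkn : k ≤ n)
    (R : ℝ) (hR : 0 < R)
    (u : ℝ → EuclideanSpace ℝ (Fin n) → ℝ)
    (hu : IsSolutionP n k (Metric.ball (0 : EuclideanSpace ℝ (Fin n)) R) u)
    (θ : EuclideanSpace ℝ (Fin n) → ℝ)
    (hθ : IsStarSolution n k (Metric.ball (0 : EuclideanSpace ℝ (Fin n)) R) θ)
    (huniq : ∀ θ' : EuclideanSpace ℝ (Fin n) → ℝ,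
      IsStarSolution n k (Metric.ball (0 : EuclideanSpace ℝ (Fin n)) R) θ' →
      ∀ x ∈ closure (Metric.ball (0 : EuclideanSpace ℝ (Fin n)) R), θ' x = θ x)
    (a b : ℝ) (ha : 1 ≤ a) (hb0 : 0 < b) (hb1 : b ≤ 1)
    (hinit : ∀ x ∈ closure (Metric.ball (0 : EuclideanSpace ℝ (Fin n)) R),
      a * θ x ≤ u 0 x ∧ u 0 x ≤ b * θ x) :
    (∀ x ∈ closure (Metric.ball (0 : EuclideanSpace ℝ (Fin n)) R),
      ∀ y ∈ closure (Metric.ball (0 : EuclideanSpace ℝ (Fin n)) R),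
        ‖x‖ = ‖y‖ → θ x = θ y) ∧
    Tendsto (fun t : ℝ =>
        supAbs n (closure (Metric.ball (0 : EuclideanSpace ℝ (Fin n)) R))
          (fun x => (1 + t) ^ ((1 : ℝ) / ((k : ℝ) - 1)) * u t x - θ x))
      atTop (nhds 0) := by
  refine ⟨?_, ?_⟩
  · intro x hx y hy hxy
    have h := huniq _ (star_rot n k hR θ hθ (Submodule.reflection (Submodule.span ℝ {x - y})ᗮ)) x hx
    have h2 : (Submodule.reflection (Submodule.span ℝ {x - y})ᗮ) x = y := Submodule.reflection_sub hxy
    simp only [h2] at h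
    exact h.symm
  · rw [Metric.tendsto_atTop']
    intro ε hε
    obtain ⟨N, hN⟩ := eventually_atTop.1 (main_conv hk hR hu hθ (ε / 2) (by positivity))
    refine ⟨N, fun t ht => ?_⟩
    have h1 : supAbs n (closure (Metric.ball (0 : EuclideanSpace ℝ (Fin n)) R))
          (fun x => (1 + t) ^ ((1 : ℝ) / ((k : ℝ) - 1)) * u t x - θ x) ≤ ε / 2 := by
      refine Real.sSup_le ?_ (by positivity)
      rintro _ ⟨x, hx, rfl⟩
      rw [clb n hR] at hx
      exact hN t ht.le x hx
    have h0 : 0 ≤ supAbs n (closure (Metric.ball (0 : EuclideanSpace ℝ (Fin n)) R))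
          (fun x => (1 + t) ^ ((1 : ℝ) / ((k : ℝ) - 1)) * u t x - θ x) := by
      refine Real.sSup_nonneg ?_
      rintro _ ⟨x, hx, rfl⟩
      exact abs_nonneg _
    rw [Real.dist_eq, sub_zero, abs_of_nonneg h0]
    linarith
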